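/- Let u be an internal node of T. Then every node v in the left subtree L_u and every node w in the right subtree R_u satisfy A_d(v) > A_d(w). (Interpretation: in the embedding of T onto the line where each node v is placed at coordinate A_d(v), all nodes of the left subtree of u appear strictly after all nodes of the right subtree of u.) -/

import Mathlib

namespace StocOrient

/-- State along a root-to-node walk in the tree `T`:
current node's size `sz`, residual budget `bu`, distance traveled `dist`
(i.e. `A_d`), and size instantiated `inst` (i.e. `A_s`). -/
structure St where
  sz : ℚ
  bu : ℚ
  dist : ℚ
  inst : ℚ

/-- One step from a node at level `lvl` to one of its children
(`true` = right child, `false` = left child); the child is at level `lvl - 1`. -/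
def step (lvl : ℕ) (x : St) (dir : Bool) : St :=
  if dir then
    { sz := x.sz * (2 : ℚ) ^ ((2 : ℤ) ^ (lvl - 1)),
      bu := x.bu - x.sz,
      dist := x.dist,
      inst := x.inst + x.sz }
  else
    { sz := x.sz * (2 : ℚ) ^ (-((2 : ℤ) ^ (lvl - 1))),
      bu := x.sz,
      dist := x.dist + (x.bu - x.sz),
      inst := x.inst }

def walkAux : ℕ → St → List Bool → St
  | _, x, [] => x
  | lvl, x, d :: rest => walkAux (lvl - 1) (step lvl x d) rest

/-- The budget `B = 2^(2^(L+1))`. -/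
def Bq (L : ℕ) : ℚ := 2 ^ 2 ^ (L + 1)

/-- Data at the root: `s_ρ = 2^(2^L)`, `b(ρ) = B`, `A_d(ρ) = A_s(ρ) = 0`. -/
def start (L : ℕ) : St := ⟨2 ^ 2 ^ L, Bq L, 0, 0⟩

/-- A node of the tree `T` is identified with its root-to-node path
(`true` = right branch); nodes of `T` are exactly the paths of length `< L`. -/
def walk (L : ℕ) (v : List Bool) : St := walkAux L (start L) v

/-- The size `s_v`. -/
def size (L : ℕ) (v : List Bool) : ℚ := (walk L v).sz

/-- The residual budget `b(v)`. -/
def budget (L : ℕ) (v : List Bool) : ℚ := (walk L v).bu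

/-- `A_d(v)`: total edge length on the root-to-`v` path. -/
def Ad (L : ℕ) (v : List Bool) : ℚ := (walk L v).dist

/-- `A_s(v)`: total size of strict ancestors of `v` from which the path to `v`
goes right. -/
def As (L : ℕ) (v : List Bool) : ℚ := (walk L v).inst

/-- The level `ℓ(v)`: the root is at level `L`, the leaves at level `1`. -/
def level (L : ℕ) (v : List Bool) : ℕ := L - v.length

end StocOrient

open StocOrient

namespace StocOrient

/-- The residual budget at level `n` is at least `2 ^ 2 ^ n - 1` times the (positive) size. -/
def BudgetDominates (n : ℕ) (x : St) : Prop :=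
  0 < x.sz ∧ x.sz * (2 ^ 2 ^ n - 1) ≤ x.bu

lemma two_le_two_pow_two_pow (n : ℕ) : (2 : ℚ) ≤ 2 ^ 2 ^ n :=
  le_self_pow₀ (by norm_num) (by positivity)

lemma BudgetDominates.sz_le_bu {n : ℕ} {x : St} (h : BudgetDominates n x) : x.sz ≤ x.bu := by
  obtain ⟨h0, h1⟩ := h
  nlinarith [two_le_two_pow_two_pow n]

lemma BudgetDominates.bu_pos {n : ℕ} {x : St} (h : BudgetDominates n x) : 0 < x.bu :=
  h.1.trans_le h.sz_le_bu

lemma step_sz_true (n : ℕ) (x : St) : (step (n + 1) x true).sz = x.sz * 2 ^ 2 ^ n := by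
  have h : (2 : ℚ) ^ ((2 : ℤ) ^ n) = 2 ^ 2 ^ n := by exact_mod_cast zpow_natCast (2 : ℚ) (2 ^ n)
  simp [step, h]

lemma step_sz_false (n : ℕ) (x : St) : (step (n + 1) x false).sz = x.sz / 2 ^ 2 ^ n := by
  have h : (2 : ℚ) ^ ((2 : ℤ) ^ n) = 2 ^ 2 ^ n := by exact_mod_cast zpow_natCast (2 : ℚ) (2 ^ n)
  simp [step, zpow_neg, h, div_eq_mul_inv]

lemma BudgetDominates.step {n : ℕ} {x : St} (h : BudgetDominates (n + 1) x) (d : Bool) :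
    BudgetDominates n (step (n + 1) x d) := by
  obtain ⟨h0, h1⟩ := h
  have h2 := two_le_two_pow_two_pow n
  have hsq : (2 : ℚ) ^ 2 ^ (n + 1) = 2 ^ 2 ^ n * 2 ^ 2 ^ n := by
    rw [← pow_add]; congr 1; ring
  rw [hsq] at h1
  cases d
  · have hbu : (StocOrient.step (n + 1) x false).bu = x.sz := by simp [StocOrient.step]
    rw [BudgetDominates, step_sz_false, hbu]
    refine ⟨by positivity, ?_⟩
    rw [div_mul_eq_mul_div, div_le_iff₀ (by positivity)]
    nlinarith
  · have hbu : (StocOrient.step (n + 1) x true).bu = x.bu - x.sz := by simp [StocOrient.step]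
    rw [BudgetDominates, step_sz_true, hbu]
    refine ⟨by positivity, ?_⟩
    nlinarith

lemma BudgetDominates.dist_le_step {n : ℕ} {x : St} (h : BudgetDominates n x)
    (m : ℕ) (d : Bool) : x.dist ≤ (StocOrient.step m x d).dist := by
  have := h.sz_le_bu
  cases d <;> simp [StocOrient.step, this]

lemma BudgetDominates.step_dist_add_bu_le {n : ℕ} {x : St} (h : BudgetDominates n x)
    (m : ℕ) (d : Bool) :
    (StocOrient.step m x d).dist + (StocOrient.step m x d).bu ≤ x.dist + x.bu := by
  have := h.1
  cases d <;> simp [StocOrient.step] <;> linarith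

lemma BudgetDominates.walkAux {n : ℕ} {x : St} (h : BudgetDominates n x) {l : List Bool}
    (hl : l.length ≤ n) :
    BudgetDominates (n - l.length) (walkAux n x l) ∧ x.dist ≤ (walkAux n x l).dist ∧
      (walkAux n x l).dist + (walkAux n x l).bu ≤ x.dist + x.bu := by
  induction l generalizing n x with
  | nil => exact ⟨h, le_rfl, le_rfl⟩
  | cons d l ih =>
    obtain _ | n := n
    · simp at hl
    obtain ⟨h1, h2, h3⟩ := ih (h.step d) (by simpa using hl)
    rw [List.length_cons, Nat.add_sub_add_right]
    exact ⟨h1, (h.dist_le_step _ d).trans h2, h3.trans (h.step_dist_add_bu_le _ d)⟩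

lemma walkAux_append (n : ℕ) (x : St) (l m : List Bool) :
    walkAux n x (l ++ m) = walkAux (n - l.length) (walkAux n x l) m := by
  induction l generalizing n x with
  | nil => rfl
  | cons d l ih =>
    simp only [List.cons_append, walkAux, ih, List.length_cons]
    congr 1
    omega

lemma budgetDominates_start (L : ℕ) : BudgetDominates L (start L) := by
  refine ⟨by simp [start], ?_⟩
  have hsq : (2 : ℚ) ^ 2 ^ (L + 1) = 2 ^ 2 ^ L * 2 ^ 2 ^ L := by
    rw [← pow_add]; congr 1; ring
  have := two_le_two_pow_two_pow L
  simp only [start, Bq, hsq]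
  nlinarith

end StocOrient

/-- For an internal node `u`, every node `v` of the left subtree `L_u` and
every node `w` of the right subtree `R_u` satisfy `A_d(v) > A_d(w)`: in the
line embedding all of `L_u` appears strictly after all of `R_u`. -/
theorem stmt13 (L : ℕ) (hL : 2 ≤ L) (u v w : List Bool)
    (hv : v.length < L) (hvpre : (u ++ [false]) <+: v)
    (hw : w.length < L) (hwpre : (u ++ [true]) <+: w) :
    Ad L w < Ad L v := by
  obtain ⟨v, rfl⟩ := hvpre
  obtain ⟨w, rfl⟩ := hwpre
  simp only [List.length_append, List.length_singleton] at hv hw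
  have hu := ((budgetDominates_start L).walkAux (l := u) (by omega)).1
  obtain ⟨n, hn⟩ : ∃ n, L - u.length = n + 1 := ⟨L - u.length - 1, by omega⟩
  simp only [Ad, walk, List.append_assoc, List.singleton_append, walkAux_append L _ u]
  rw [hn] at hu ⊢
  generalize walkAux L (start L) u = x at hu
  have hleft := ((hu.step false).walkAux (l := v) (by omega)).2.1
  obtain ⟨hbu, -, hright⟩ := (hu.step true).walkAux (l := w) (by omega)
  calc (walkAux n (step (n + 1) x true) w).dist
      < (step (n + 1) x true).dist + (step (n + 1) x true).bu := by linarith [hbu.bu_pos]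
    _ = (step (n + 1) x false).dist := by simp [step]
    _ ≤ (walkAux n (step (n + 1) x false) v).dist := hleft
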